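/- With the augmented reduction construction below (where k ≥ 2), the graph G admits a k-clique if and only if there exists an injection σ : X' → Y' with dist(σ) ≤ ρ. -/

import Mathlib

/-- Circular distance between the `j`-th and `j'`-th of `m` points spaced regularly
on a circle of perimeter 1: `(1/m) · min(j'−j, m+j−j')` for `j ≤ j'`. -/
noncomputable def ringDist (m : ℕ) (j j' : Fin m) : ℝ :=
  ((min (max j.val j'.val - min j.val j'.val)
        (m - (max j.val j'.val - min j.val j'.val)) : ℕ) : ℝ) / (m : ℝ)

/-- The distance on `Y = R_1 ∪ … ∪ R_k`, where `R_i = {p_{i1},…,p_{im}}` and the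
point `p_{ij}` (with `1 ≤ i ≤ k`, `1 ≤ j ≤ m`) is encoded as
`(⟨i-1⟩, ⟨j-1⟩) : Fin k × Fin m`.  Within a ring the distance is the circular
distance `ringDist`; for `i ≠ i'`, `d_Y(p_{ij}, p_{i'j'}) = 2^{max(i,i')}` if
`(v_j, v_{j'}) ∈ E` and `2^{max(i,i')} − 1/m` otherwise. -/
noncomputable def dY (m k : ℕ) (G : SimpleGraph (Fin m)) [DecidableRel G.Adj]
    (p q : Fin k × Fin m) : ℝ :=
  if p.1 = q.1 then ringDist m p.2 q.2
  else if G.Adj p.2 q.2 then (2 : ℝ) ^ (max p.1.val q.1.val + 1)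
  else (2 : ℝ) ^ (max p.1.val q.1.val + 1) - 1 / (m : ℝ)

/-- The augmented pattern `X' = {x_1,…,x_k, x_{k+1}}`, encoded as `Fin (k+1)`
with `x_{k+1} = Fin.last k`: `d_X(x_i, x_{i'}) = 2^{max(i,i')}·ρ` for distinct
`i, i' ≤ k`, and `d_X(x_i, x_{k+1}) = λ = 5mρ²·2^k`. -/
noncomputable def dX' (k m : ℕ) (ρ : ℝ) (i i' : Fin (k + 1)) : ℝ :=
  if i = i' then 0
  else if i = Fin.last k ∨ i' = Fin.last k then 5 * (m : ℝ) * ρ ^ 2 * 2 ^ k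
  else (2 : ℝ) ^ (max i.val i'.val + 1) * ρ

/-- The augmented space `Y' = Y ∪ {p_{k+1}}`, encoded as
`Option (Fin k × Fin m)` with `p_{k+1} = none`: the extra point `p_{k+1}` is at
distance `λ = 5mρ²·2^k` from every point of `Y`. -/
noncomputable def dY' (m k : ℕ) (G : SimpleGraph (Fin m)) [DecidableRel G.Adj]
    (ρ : ℝ) (p q : Option (Fin k × Fin m)) : ℝ :=
  match p, q with
  | none, none => 0
  | none, some _ => 5 * (m : ℝ) * ρ ^ 2 * 2 ^ k
  | some _, none => 5 * (m : ℝ) * ρ ^ 2 * 2 ^ k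
  | some a, some b => dY m k G a b

/-- The expansion of a map `σ` between spaces with distance functions `dA, dB`:
the maximum over distinct `x, x'` of `dB (σ x) (σ x') / dA x x'`. -/
noncomputable def expansionD {X Y : Type*} (dA : X → X → ℝ) (dB : Y → Y → ℝ)
    (σ : X → Y) : ℝ :=
  sSup {t : ℝ | ∃ x x' : X, x ≠ x' ∧ t = dB (σ x) (σ x') / dA x x'}

/-- The expansion of the inverse of an injection `σ`:
the maximum over distinct `x, x'` of `dA x x' / dB (σ x) (σ x')`. -/
noncomputable def expansionInvD {X Y : Type*} (dA : X → X → ℝ) (dB : Y → Y → ℝ)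
    (σ : X → Y) : ℝ :=
  sSup {t : ℝ | ∃ x x' : X, x ≠ x' ∧ t = dA x x' / dB (σ x) (σ x')}

lemma ringDist_le_one {m : ℕ} (j j' : Fin m) : ringDist m j j' ≤ 1 := by
  have hj := j.isLt
  unfold ringDist
  rw [div_le_one (by exact_mod_cast (by omega : 0 < m))]
  exact_mod_cast (by omega)

lemma one_div_le_ringDist {m : ℕ} {j j' : Fin m} (h : j ≠ j') :
    1 / (m : ℝ) ≤ ringDist m j j' := by
  have hj := j.isLt
  have hj' := j'.isLt
  have hne : j.val ≠ j'.val := fun e => h (Fin.ext e)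
  unfold ringDist
  gcongr
  rw [Nat.one_le_cast]
  omega

lemma one_div_natCast_le_one (m : ℕ) : 1 / (m : ℝ) ≤ 1 := by
  rw [one_div]
  exact Nat.cast_inv_le_one m

section

variable {m k : ℕ} (G : SimpleGraph (Fin m)) [DecidableRel G.Adj]

lemma dY_le (p q : Fin k × Fin m) :
    dY m k G p q ≤ 2 ^ (max p.1.val q.1.val + 1) := by
  have h1 : (1 : ℝ) ≤ 2 ^ (max p.1.val q.1.val + 1) := one_le_pow₀ (by norm_num)
  have h2 : 0 ≤ 1 / (m : ℝ) := by positivity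
  unfold dY
  split_ifs
  · exact (ringDist_le_one _ _).trans h1
  · exact le_rfl
  · linarith

lemma dY_le_two_pow (p q : Fin k × Fin m) : dY m k G p q ≤ 2 ^ k :=
  (dY_le G p q).trans (pow_le_pow_right₀ (by norm_num) (by omega))

lemma one_div_le_dY {p q : Fin k × Fin m} (h : p ≠ q) : 1 / (m : ℝ) ≤ dY m k G p q := by
  have h1 : (2 : ℝ) ≤ 2 ^ (max p.1.val q.1.val + 1) := by
    simpa using pow_le_pow_right₀ (by norm_num : (1 : ℝ) ≤ 2)
      (by omega : 1 ≤ max p.1.val q.1.val + 1)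
  have h2 := one_div_natCast_le_one m
  unfold dY
  split_ifs with h3
  · exact one_div_le_ringDist fun e => h (Prod.ext h3 e)
  · linarith
  · linarith

lemma one_div_le_dY' (hm : 1 ≤ m) {ρ : ℝ} (hρ : 1 ≤ ρ) {p q : Option (Fin k × Fin m)}
    (h : p ≠ q) : 1 / (m : ℝ) ≤ dY' m k G ρ p q := by
  have hm' : (1 : ℝ) ≤ m := by exact_mod_cast hm
  have h1 : (1 : ℝ) ≤ 5 * (m : ℝ) * ρ ^ 2 * 2 ^ k :=
    one_le_mul_of_one_le_of_one_le
      (one_le_mul_of_one_le_of_one_le (by linarith) (one_le_pow₀ hρ))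
      (one_le_pow₀ (by norm_num))
  have h2 := (one_div_natCast_le_one m).trans h1
  match p, q with
  | none, none => exact absurd rfl h
  | none, some _ => exact h2
  | some _, none => exact h2
  | some a, some b => exact one_div_le_dY G fun e => h (congrArg some e)

end

lemma le_sSup_ratio {X : Type*} [Finite X] (f : X → X → ℝ) {x x' : X} (h : x ≠ x') :
    f x x' ≤ sSup {t : ℝ | ∃ x x' : X, x ≠ x' ∧ t = f x x'} := by
  refine le_csSup (Set.Finite.bddAbove ?_) ⟨x, x', h, rfl⟩
  refine (Set.finite_range fun z : X × X => f z.1 z.2).subset ?_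
  rintro t ⟨x, x', -, rfl⟩
  exact ⟨(x, x'), rfl⟩

lemma ratio_mul_ratio_le {X Y : Type*} [Finite X] {dA : X → X → ℝ} {dB : Y → Y → ℝ}
    {σ : X → Y} {ρ : ℝ} (hσ : expansionD dA dB σ * expansionInvD dA dB σ ≤ ρ)
    (hA : ∀ x x', 0 ≤ dA x x') (hB : ∀ x x', x ≠ x' → 0 ≤ dB (σ x) (σ x'))
    {x x' y y' : X} (hx : x ≠ x') (hy : y ≠ y') :
    dB (σ x) (σ x') / dA x x' * (dA y y' / dB (σ y) (σ y')) ≤ ρ := by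
  have h1 : dB (σ x) (σ x') / dA x x' ≤ expansionD dA dB σ :=
    le_sSup_ratio (fun x x' => dB (σ x) (σ x') / dA x x') hx
  have h2 : dA y y' / dB (σ y) (σ y') ≤ expansionInvD dA dB σ :=
    le_sSup_ratio (fun x x' => dA x x' / dB (σ x) (σ x')) hy
  have h3 := div_nonneg (hB x x' hx) (hA x x')
  have h4 := div_nonneg (hA y y') (hB y y' hy)
  exact (mul_le_mul h1 h2 h4 (h3.trans h1)).trans hσ

lemma dX'_nonneg (k m : ℕ) {ρ : ℝ} (hρ : 0 ≤ ρ) (i i' : Fin (k + 1)) :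
    0 ≤ dX' k m ρ i i' := by
  unfold dX'
  split_ifs <;> positivity

lemma dX'_last {k m : ℕ} {ρ : ℝ} {i : Fin (k + 1)} (h : i ≠ Fin.last k) :
    dX' k m ρ (Fin.last k) i = 5 * (m : ℝ) * ρ ^ 2 * 2 ^ k := by
  simp [dX', h.symm]

lemma dX'_castSucc {k m : ℕ} {ρ : ℝ} {i i' : Fin k} (h : i ≠ i') :
    dX' k m ρ i.castSucc i'.castSucc = 2 ^ (max i.val i'.val + 1) * ρ := by
  simp [dX', h, Fin.castSucc_ne_last]

/-- A permutation that never decreases the maximum of two distinct points preserves it. -/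
lemma max_perm_eq {k : ℕ} (e : Equiv.Perm (Fin k))
    (h : ∀ i j, i ≠ j → max i.val j.val ≤ max (e i).val (e j).val) {i j : Fin k} (hij : i ≠ j) :
    max i.val j.val = max (e i).val (e j).val := by
  let f : Fin k × Fin k → ℕ := fun z => if z.1 = z.2 then 0 else max z.1.val z.2.val
  have hle : ∀ z ∈ Finset.univ, f z ≤ f (e.prodCongr e z) := by
    rintro ⟨a, b⟩ -
    by_cases hab : a = b
    · simp [f, hab]
    · simpa [f, hab] using h a b hab
  have hsum : ∑ z, f z = ∑ z, f (e.prodCongr e z) := ((e.prodCongr e).sum_comp f).symm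
  simpa [f, hij] using (Finset.sum_eq_sum_iff_of_le hle).1 hsum (i, j) (Finset.mem_univ _)

lemma exists_embedding_of_clique {m k : ℕ} {ρ : ℝ} (hm : 1 ≤ m) (hρ : 1 ≤ ρ)
    (G : SimpleGraph (Fin m)) [DecidableRel G.Adj] {s : Finset (Fin m)} (hs : G.IsNClique k s) :
    ∃ σ : Fin (k + 1) → Option (Fin k × Fin m), Function.Injective σ ∧
      expansionD (dX' k m ρ) (dY' m k G ρ) σ *
      expansionInvD (dX' k m ρ) (dY' m k G ρ) σ ≤ ρ := by
  have hρ0 : 0 < ρ := by linarith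
  have hm0 : (0 : ℝ) < m := by exact_mod_cast hm
  let c := s.orderEmbOfFin hs.card_eq
  let σ : Fin (k + 1) → Option (Fin k × Fin m) :=
    Fin.lastCases none fun i => some (i, c i)
  have hlast : σ (Fin.last k) = none := Fin.lastCases_last
  have hcast (i : Fin k) : σ i.castSucc = some (i, c i) := Fin.lastCases_castSucc i
  have hd : ∀ x x', x ≠ x' → 0 < dX' k m ρ x x' ∧
      (dY' m k G ρ (σ x) (σ x') = dX' k m ρ x x' ∨
        dY' m k G ρ (σ x) (σ x') = dX' k m ρ x x' / ρ) := by
    intro x x' hx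
    induction x using Fin.lastCases with
    | last =>
      induction x' using Fin.lastCases with
      | last => exact absurd rfl hx
      | cast j =>
        rw [dX'_last hx.symm, hlast, hcast]
        exact ⟨by positivity, Or.inl rfl⟩
    | cast i =>
      induction x' using Fin.lastCases with
      | last =>
        have : dX' k m ρ i.castSucc (Fin.last k) = 5 * (m : ℝ) * ρ ^ 2 * 2 ^ k := by
          simp [dX', hx]
        rw [this, hlast, hcast]
        exact ⟨by positivity, Or.inl rfl⟩
      | cast j =>
        have hij : i ≠ j := fun e => hx (congrArg _ e)
        have hadj : G.Adj (c i) (c j) := hs.isClique (s.orderEmbOfFin_mem _ _)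
          (s.orderEmbOfFin_mem _ _) (c.injective.ne hij)
        rw [dX'_castSucc hij, hcast, hcast]
        refine ⟨by positivity, Or.inr ?_⟩
        simp [dY', dY, hij, hadj, hρ0.ne']
  refine ⟨σ, ?_, ?_⟩
  · intro x x' h
    induction x using Fin.lastCases <;> induction x' using Fin.lastCases <;>
      simp_all
  · have h1 : expansionD (dX' k m ρ) (dY' m k G ρ) σ ≤ 1 := by
      refine Real.sSup_le ?_ zero_le_one
      rintro t ⟨x, x', hx, rfl⟩
      obtain ⟨h0, h | h⟩ := hd x x' hx
      · rw [h, div_self h0.ne']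
      · rw [h, div_le_one h0]
        exact div_le_self h0.le hρ
    have h2 : expansionInvD (dX' k m ρ) (dY' m k G ρ) σ ≤ ρ := by
      refine Real.sSup_le ?_ hρ0.le
      rintro t ⟨x, x', hx, rfl⟩
      obtain ⟨h0, h | h⟩ := hd x x' hx
      · rwa [h, div_self h0.ne']
      · rw [h, div_div_cancel₀ h0.ne']
    have h3 : 0 ≤ expansionInvD (dX' k m ρ) (dY' m k G ρ) σ := by
      refine Real.sSup_nonneg ?_
      rintro t ⟨x, x', hx, rfl⟩
      obtain ⟨h0, h | h⟩ := hd x x' hx <;> rw [h] <;> positivity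
    simpa using mul_le_mul h1 h2 h3 zero_le_one

lemma map_last_eq_none {m k : ℕ} {ρ : ℝ} (hm : 1 ≤ m) (hk : 2 ≤ k) (hρ : 1 ≤ ρ)
    (G : SimpleGraph (Fin m)) [DecidableRel G.Adj]
    {σ : Fin (k + 1) → Option (Fin k × Fin m)} (hinj : Function.Injective σ)
    (hσ : ∀ x x' y y', x ≠ x' → y ≠ y' → dY' m k G ρ (σ x) (σ x') / dX' k m ρ x x' *
      (dX' k m ρ y y' / dY' m k G ρ (σ y) (σ y')) ≤ ρ) :
    σ (Fin.last k) = none := by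
  have hρ0 : 0 < ρ := by linarith
  have hm0 : (0 : ℝ) < m := by exact_mod_cast hm
  by_contra hne
  obtain ⟨a, ha⟩ := Option.ne_none_iff_exists'.1 hne
  let i₀ : Fin k := ⟨0, by omega⟩
  let i₁ : Fin k := ⟨1, by omega⟩
  have h01 : i₀ ≠ i₁ := by simp [i₀, i₁]
  have h01' : i₀.castSucc ≠ i₁.castSucc := (Fin.castSucc_injective k).ne h01
  obtain ⟨j, b, hb⟩ : ∃ (j : Fin k) (b : _), σ j.castSucc = some b := by
    by_contra! h
    have h0 := Option.eq_none_iff_forall_ne_some.2 (h i₀)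
    have h1 := Option.eq_none_iff_forall_ne_some.2 (h i₁)
    exact h01' (hinj (h0.trans h1.symm))
  have hj := Fin.castSucc_ne_last j
  have hab : a ≠ b := by
    rintro rfl
    exact hj (hinj (hb.trans ha.symm))
  have h1 := one_div_le_dY' G hm hρ (hinj.ne h01')
  have h2 := dY_le_two_pow G a b
  have h3 : 0 < dY m k G a b := lt_of_lt_of_le (by positivity) (one_div_le_dY G hab)
  have h4 : dX' k m ρ i₀.castSucc i₁.castSucc = 4 * ρ := by
    rw [dX'_castSucc h01]
    norm_num [i₀, i₁]
  have h5 := hσ _ _ _ _ h01' hj.symm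
  rw [h4, dX'_last hj, ha, hb] at h5
  have h6 : 5 * (m : ℝ) * ρ ^ 2 ≤ 5 * (m : ℝ) * ρ ^ 2 * 2 ^ k / dY' m k G ρ (some a) (some b) :=
    (le_div_iff₀ h3).2 (mul_le_mul_of_nonneg_left h2 (by positivity))
  have h7 : 1 / (m : ℝ) / (4 * ρ) * (5 * (m : ℝ) * ρ ^ 2) ≤ ρ :=
    le_trans (mul_le_mul (div_le_div_of_nonneg_right h1 (by positivity)) h6 (by positivity)
      (div_nonneg (le_trans (by positivity) h1) (by positivity))) h5
  have h8 : 1 / (m : ℝ) / (4 * ρ) * (5 * (m : ℝ) * ρ ^ 2) = 5 / 4 * ρ := by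
    field_simp
  linarith

lemma exists_clique_of_embedding {m k : ℕ} {ρ : ℝ} (hm : 1 ≤ m) (hk : 2 ≤ k) (hρ : 1 ≤ ρ)
    (G : SimpleGraph (Fin m)) [DecidableRel G.Adj]
    {σ : Fin (k + 1) → Option (Fin k × Fin m)} (hinj : Function.Injective σ)
    (hdist : expansionD (dX' k m ρ) (dY' m k G ρ) σ *
      expansionInvD (dX' k m ρ) (dY' m k G ρ) σ ≤ ρ) :
    ∃ s : Finset (Fin m), G.IsNClique k s := by
  have hρ0 : 0 < ρ := by linarith
  have hm0 : (0 : ℝ) < m := by exact_mod_cast hm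
  have hσ : ∀ x x' y y', x ≠ x' → y ≠ y' → dY' m k G ρ (σ x) (σ x') / dX' k m ρ x x' *
      (dX' k m ρ y y' / dY' m k G ρ (σ y) (σ y')) ≤ ρ := fun x x' y y' hx hy =>
    ratio_mul_ratio_le hdist (dX'_nonneg k m hρ0.le)
      (fun x x' h => le_trans (by positivity) (one_div_le_dY' G hm hρ (hinj.ne h))) hx hy
  have hlast := map_last_eq_none hm hk hρ G hinj hσ
  have hsome (i : Fin k) : ∃ p, σ i.castSucc = some p :=
    Option.ne_none_iff_exists'.1 fun h => Fin.castSucc_ne_last i (hinj (h.trans hlast.symm))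
  choose p hp using hsome
  have hpinj : Function.Injective p := fun i j h =>
    Fin.castSucc_injective k (hinj (by rw [hp, hp, h]))
  have hlow (i j : Fin k) (hij : i ≠ j) :
      (2 : ℝ) ^ (max i.val j.val + 1) ≤ dY m k G (p i) (p j) := by
    have hpos : 0 < dY m k G (p i) (p j) :=
      lt_of_lt_of_le (by positivity) (one_div_le_dY G (hpinj.ne hij))
    have h := hσ _ _ _ _ (Fin.castSucc_ne_last i).symm ((Fin.castSucc_injective k).ne hij)
    rw [dX'_last (Fin.castSucc_ne_last i), dX'_castSucc hij, hlast, hp, hp] at h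
    have h1 : dY' m k G ρ none (some (p i)) / (5 * (m : ℝ) * ρ ^ 2 * 2 ^ k) = 1 :=
      div_self (a := 5 * (m : ℝ) * ρ ^ 2 * 2 ^ k) (by positivity)
    rw [h1, one_mul] at h
    have h2 := (div_le_iff₀ hpos).1 h
    rw [mul_comm] at h2
    exact le_of_mul_le_mul_left h2 hρ0
  have hrinj : Function.Injective fun i => (p i).1 := by
    intro i j h
    by_contra hij
    have h1 := hlow i j hij
    have h2 : (2 : ℝ) ^ 1 ≤ 2 ^ (max i.val j.val + 1) :=
      pow_le_pow_right₀ (by norm_num) (by omega)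
    have h3 : dY m k G (p i) (p j) ≤ 1 := by
      simpa [dY, show (p i).1 = (p j).1 from h] using ringDist_le_one (p i).2 (p j).2
    linarith
  let e : Equiv.Perm (Fin k) := Equiv.ofBijective _ (Finite.injective_iff_bijective.1 hrinj)
  have hmax (i j : Fin k) (hij : i ≠ j) :
      max i.val j.val = max (p i).1.val (p j).1.val := by
    refine max_perm_eq e (fun i j hij => ?_) hij
    have h := (pow_le_pow_iff_right₀ (by norm_num : (1 : ℝ) < 2)).1
      ((hlow i j hij).trans (dY_le G (p i) (p j)))
    exact Nat.le_of_succ_le_succ h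
  have hadj (i j : Fin k) (hij : i ≠ j) : G.Adj (p i).2 (p j).2 := by
    by_contra hna
    have h := hlow i j hij
    have h1 : 0 < 1 / (m : ℝ) := by positivity
    rw [hmax i j hij, dY, if_neg (hrinj.ne hij), if_neg hna] at h
    linarith
  have hcinj : Function.Injective fun i => (p i).2 := fun i j h => by
    by_contra hij
    exact (hadj i j hij).ne h
  refine ⟨Finset.univ.map ⟨_, hcinj⟩, ?_, by simp⟩
  intro x hx y hy hxy
  simp only [Finset.coe_map, Function.Embedding.coeFn_mk, Finset.coe_univ, Set.image_univ,
    Set.mem_range] at hx hy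
  obtain ⟨i, rfl⟩ := hx
  obtain ⟨j, rfl⟩ := hy
  exact hadj i j fun e => hxy (by rw [e])

/-- **Correctness of the reduction to minimum distortion.** With the augmented
reduction construction (with `2 ≤ k ≤ m`, `m ≥ 24`, `ρ ≥ 1`), the graph `G`
admits a `k`-clique if and only if there exists an injection `σ : X' → Y'`
with `dist(σ) = expansion(σ)·expansion(σ⁻¹) ≤ ρ`. -/
theorem stmt_18 (m k : ℕ) (hm : 24 ≤ m) (hk : 2 ≤ k) (hkm : k ≤ m)
    (ρ : ℝ) (hρ : 1 ≤ ρ) (G : SimpleGraph (Fin m)) [DecidableRel G.Adj] :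
    (∃ s : Finset (Fin m), G.IsNClique k s) ↔
    (∃ σ : Fin (k + 1) → Option (Fin k × Fin m), Function.Injective σ ∧
      expansionD (dX' k m ρ) (dY' m k G ρ) σ *
      expansionInvD (dX' k m ρ) (dY' m k G ρ) σ ≤ ρ) := by
  exact ⟨fun ⟨_, hs⟩ => exists_embedding_of_clique (by omega) hρ G hs,
    fun ⟨_, hinj, hσ⟩ => exists_clique_of_embedding (by omega) hk hρ G hinj hσ⟩
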